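/- arXiv:2408.04128 — 3 statements merged into one kernel-verified Lean document; each statement's English description precedes it below -/
import Mathlib

section
/- Let A be an n×n complex matrix, k ≥ 0, and i,j ∈ {1,…,n}. If both i ∈ Δ_{ij}^{(k)} and j ∈ Δ_{ij}^{(k)}, then for every polynomial p with complex coefficients of degree at most k, [p(A)]_{ij} = [p(B)]_{𝕆(i),𝕆(j)}, where B := A[Δ_{ij}^{(k)}, Δ_{ij}^{(k)}] is the principal submatrix of A indexed by Δ_{ij}^{(k)} and 𝕆 is the order bijection on Δ_{ij}^{(k)}. -/
/-- The set of non-zero diagonal offsets of an `n × n` complex matrix `A`. -/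
def NDset (n : ℕ) (A : Matrix (Fin n) (Fin n) ℂ) : Set ℤ :=
  {r | ∃ i j : Fin n, (j : ℤ) - (i : ℤ) = r ∧ A i j ≠ 0}

/-- `S_0(A) = {0}` and, for `k ≥ 1`,
`S_k(A) = { z ∈ {-(n-1),…,n-1} : z = r_1 + ⋯ + r_k, r_t ∈ ND(A) }`. -/
def Sset (n : ℕ) (A : Matrix (Fin n) (Fin n) ℂ) : ℕ → Set ℤ
  | 0 => {0}
  | (k + 1) => {z | |z| ≤ (n : ℤ) - 1 ∧
      ∃ r : Fin (k + 1) → ℤ, (∀ t, r t ∈ NDset n A) ∧ z = ∑ t, r t}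

theorem Sset_add_mem {n : ℕ} {A : Matrix (Fin n) (Fin n) ℂ} {l : ℕ} {z r : ℤ}
    (hz : z ∈ Sset n A l) (hr : r ∈ NDset n A) (h : |r + z| ≤ (n : ℤ) - 1) :
    r + z ∈ Sset n A (l + 1) := by
  refine ⟨h, ?_⟩
  cases l with
  | zero =>
    obtain rfl : z = 0 := hz
    exact ⟨fun _ => r, fun _ => hr, by simp⟩
  | succ l =>
    obtain ⟨-, f, hf, rfl⟩ := hz
    refine ⟨Fin.cons r f, fun t => ?_, ?_⟩
    · refine Fin.cases ?_ (fun t => ?_) t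
      · simpa using hr
      · simpa using hf t
    · rw [Fin.sum_cons]

theorem abs_coe_sub_coe_le {n : ℕ} (u v : Fin n) : |(v : ℤ) - (u : ℤ)| ≤ (n : ℤ) - 1 := by
  rw [abs_le]
  omega

theorem sub_mem_Sset_of_pow_apply_ne_zero {n : ℕ} {A : Matrix (Fin n) (Fin n) ℂ} {m : ℕ}
    {u v : Fin n} (h : (A ^ m) u v ≠ 0) : (v : ℤ) - (u : ℤ) ∈ Sset n A m := by
  induction m generalizing u with
  | zero =>
    have huv : u = v := by
      by_contra hne
      exact h (by rw [pow_zero, Matrix.one_apply_ne hne])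
    subst huv
    exact sub_self _
  | succ m ih =>
    rw [pow_succ', Matrix.mul_apply] at h
    obtain ⟨w, -, hw⟩ := Finset.exists_ne_zero_of_sum_ne_zero h
    have key : ((w : ℤ) - (u : ℤ)) + ((v : ℤ) - (w : ℤ)) = (v : ℤ) - (u : ℤ) := by ring
    rw [← key]
    refine Sset_add_mem (ih (right_ne_zero_of_mul hw)) ⟨u, w, rfl, left_ne_zero_of_mul hw⟩ ?_
    rw [key]
    exact abs_coe_sub_coe_le u v

/-- Starting from an index of `Δ` reachable from `i` in `l` steps, walks of length at most `k - l`
ending in `j` stay inside `Δ`, so powers of `A` may be computed in the submatrix. -/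
theorem pow_apply_eq_submatrix_pow_apply {n k : ℕ} {A : Matrix (Fin n) (Fin n) ℂ}
    {i j : Fin n} {Δ : Finset (Fin n)}
    (hΔ : ∀ t : Fin n, ∀ s ≤ k, ∀ l ≤ s, (t : ℤ) - (i : ℤ) ∈ Sset n A l →
      (j : ℤ) - (t : ℤ) ∈ Sset n A (s - l) → t ∈ Δ)
    {ι : Type*} [Fintype ι] [DecidableEq ι] (e : ι ≃ Δ) (hj : j ∈ Δ) (m l : ℕ) (t : ι)
    (hlm : l + m ≤ k) (ht : ((e t : Fin n) : ℤ) - (i : ℤ) ∈ Sset n A l) :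
    (A ^ m) (e t) j =
      (A.submatrix (fun a => (e a : Fin n)) (fun a => (e a : Fin n)) ^ m) t (e.symm ⟨j, hj⟩) := by
  induction m generalizing l t with
  | zero =>
    rw [pow_zero, pow_zero, Matrix.one_apply, Matrix.one_apply]
    simp only [Equiv.eq_symm_apply, Subtype.ext_iff]
  | succ m ih =>
    have hstep : ∀ u : Fin n, A (e t) u ≠ 0 → (u : ℤ) - (i : ℤ) ∈ Sset n A (l + 1) := by
      intro u hu
      have key : ((u : ℤ) - ((e t : Fin n) : ℤ)) + (((e t : Fin n) : ℤ) - (i : ℤ)) =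
          (u : ℤ) - (i : ℤ) := by ring
      rw [← key]
      refine Sset_add_mem ht ⟨e t, u, rfl, hu⟩ ?_
      rw [key]
      exact abs_coe_sub_coe_le i u
    rw [pow_succ', pow_succ', Matrix.mul_apply, Matrix.mul_apply]
    have hsupp : ∑ u, A (e t) u * (A ^ m) u j = ∑ u ∈ Δ, A (e t) u * (A ^ m) u j := by
      symm
      refine Finset.sum_subset (Finset.subset_univ _) fun u _ hu => ?_
      by_contra hne
      refine hu (hΔ u (l + 1 + m) (by omega) (l + 1) (by omega)
        (hstep u (left_ne_zero_of_mul hne)) ?_)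
      rw [Nat.add_sub_cancel_left]
      exact sub_mem_Sset_of_pow_apply_ne_zero (right_ne_zero_of_mul hne)
    rw [hsupp, ← Finset.sum_coe_sort, ← e.sum_comp]
    refine Finset.sum_congr rfl fun a _ => ?_
    rw [Matrix.submatrix_apply]
    by_cases h : A (e t) (e a) = 0
    · rw [h, zero_mul, zero_mul]
    · rw [ih (l + 1) a (by omega) (hstep _ h)]

/-- If both `i` and `j` belong to
`Δ_{ij}^{(k)} = ( ⋃_{s=0}^{k} ⋃_{l=0}^{s} ((i + S_l(A)) ∩ (j − S_{s−l}(A))) ) ∩ {1,…,n}`,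
then `[p(A)]_{ij} = [p(B)]_{𝕆(i),𝕆(j)}` for every polynomial `p` of degree at most `k`,
where `B = A[Δ,Δ]` is the principal submatrix indexed by `Δ = Δ_{ij}^{(k)}` and `𝕆` is
the order bijection on `Δ`. -/
theorem poly_entry_eq_submatrix_poly_entry (n k : ℕ) (A : Matrix (Fin n) (Fin n) ℂ)
    (i j : Fin n) (Δ : Finset (Fin n))
    (hΔ : ∀ t : Fin n, t ∈ Δ ↔ ∃ s ≤ k, ∃ l ≤ s,
      (t : ℤ) - (i : ℤ) ∈ Sset n A l ∧ (j : ℤ) - (t : ℤ) ∈ Sset n A (s - l))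
    (hi : i ∈ Δ) (hj : j ∈ Δ)
    (p : Polynomial ℂ) (hp : p.natDegree ≤ k) :
    (Polynomial.aeval A) p i j =
      (Polynomial.aeval
          (A.submatrix (fun a : Fin Δ.card => ((Δ.orderIsoOfFin rfl) a : Fin n))
            (fun a : Fin Δ.card => ((Δ.orderIsoOfFin rfl) a : Fin n)))) p
        ((Δ.orderIsoOfFin rfl).symm ⟨i, hi⟩) ((Δ.orderIsoOfFin rfl).symm ⟨j, hj⟩) := by
  rw [Polynomial.aeval_eq_sum_range, Polynomial.aeval_eq_sum_range, Matrix.sum_apply,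
    Matrix.sum_apply]
  refine Finset.sum_congr rfl fun m hm => ?_
  rw [Matrix.smul_apply, Matrix.smul_apply]
  congr 1
  have hmk : 0 + m ≤ k := by
    rw [Finset.mem_range] at hm
    omega
  have hpow := pow_apply_eq_submatrix_pow_apply (A := A) (i := i) (j := j) (Δ := Δ)
    (fun t s hs l hl h₁ h₂ => (hΔ t).2 ⟨s, hs, l, hl, h₁, h₂⟩)
    (Δ.orderIsoOfFin rfl).toEquiv hj m 0 ((Δ.orderIsoOfFin rfl).symm ⟨i, hi⟩) hmk
    (by simp [Sset])
  simpa using hpow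
end

section
/- (Enlargement of the index set.) Let A be an n×n complex matrix, k ≥ 0, and i,j ∈ {1,…,n} with i,j ∈ Δ_{ij}^{(k)}. Let M be any subset of {1,…,n} with Δ_{ij}^{(k)} ⊆ M. Then for every polynomial p with complex coefficients of degree at most k, [p(A)]_{ij} = [p(C)]_{𝕆(i),𝕆(j)}, where C := A[M,M] is the principal submatrix of A indexed by M and 𝕆 is the order bijection on M. -/
/-- Appending one offset to a sum of `l` offsets, as long as the total stays in range. -/
theorem add_mem_Sset_succ {n : ℕ} {A : Matrix (Fin n) (Fin n) ℂ} {l : ℕ} {z r : ℤ}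
    (hz : z ∈ Sset n A l) (hr : r ∈ NDset n A) (hzr : |z + r| ≤ (n : ℤ) - 1) :
    z + r ∈ Sset n A (l + 1) := by
  refine ⟨hzr, ?_⟩
  cases l with
  | zero =>
    have hz0 : z = 0 := hz
    exact ⟨fun _ => r, fun _ => hr, by simp [hz0]⟩
  | succ l =>
    obtain ⟨-, q, hq, rfl⟩ := hz
    refine ⟨Fin.snoc q r, fun t => ?_, ?_⟩
    · induction t using Fin.lastCases with
      | last => simpa using hr
      | cast t => simpa using hq t
    · rw [Fin.sum_univ_castSucc (n := l + 1)]
      simp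

/-- Extending a walk from `i` to `t` along a non-zero entry `A t u`. -/
theorem sub_mem_Sset_succ {n : ℕ} {A : Matrix (Fin n) (Fin n) ℂ} {l : ℕ} {i t u : Fin n}
    (ht : (t : ℤ) - (i : ℤ) ∈ Sset n A l) (hA : A t u ≠ 0) :
    (u : ℤ) - (i : ℤ) ∈ Sset n A (l + 1) := by
  have h := add_mem_Sset_succ (r := (u : ℤ) - t) ht ⟨t, u, rfl, hA⟩ (by
    rw [abs_le]
    constructor <;> omega)
  rwa [show (t : ℤ) - i + (u - t) = u - i by ring] at h

theorem sub_mem_Sset_of_pow_ne_zero {n : ℕ} {A : Matrix (Fin n) (Fin n) ℂ} {m : ℕ}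
    {u j : Fin n} (h : (A ^ m) u j ≠ 0) : (j : ℤ) - (u : ℤ) ∈ Sset n A m := by
  induction m generalizing j with
  | zero =>
    have huj : u = j := by
      by_contra hne
      exact h (by simp [hne])
    subst huj
    simp [Sset]
  | succ m ih =>
    rw [pow_succ, Matrix.mul_apply] at h
    obtain ⟨w, -, hw⟩ := Finset.exists_ne_zero_of_sum_ne_zero h
    exact sub_mem_Sset_succ (ih (left_ne_zero_of_mul hw)) (right_ne_zero_of_mul hw)

/-- If the range of `e` contains every index lying on a potential walk of length `s` from `i`
to `e b`, then powers of `A` and of `A.submatrix e e` agree on the tails of such walks. -/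
theorem pow_apply_eq_submatrix_pow_apply_s5 {ι : Type*} [Fintype ι] [DecidableEq ι] {n : ℕ}
    (A : Matrix (Fin n) (Fin n) ℂ) {e : ι → Fin n} (he : Function.Injective e) (i : Fin n)
    (b : ι) (s : ℕ)
    (hs : ∀ u : Fin n, ∀ l ≤ s, (u : ℤ) - (i : ℤ) ∈ Sset n A l →
      ((e b : Fin n) : ℤ) - (u : ℤ) ∈ Sset n A (s - l) → u ∈ Set.range e)
    (m l : ℕ) (hml : l + m = s) (a : ι) (ha : ((e a : Fin n) : ℤ) - (i : ℤ) ∈ Sset n A l) :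
    (A ^ m) (e a) (e b) = ((A.submatrix e e) ^ m) a b := by
  induction m generalizing l a with
  | zero => simp [Matrix.one_apply, he.eq_iff]
  | succ m ih =>
    rw [pow_succ', pow_succ', Matrix.mul_apply, Matrix.mul_apply]
    symm
    refine Fintype.sum_of_injective e he _ _ (fun u hu => ?_) fun c => ?_
    · by_contra hne
      refine hu (hs u (l + 1) (by omega) (sub_mem_Sset_succ ha (left_ne_zero_of_mul hne)) ?_)
      rw [show s - (l + 1) = m by omega]
      exact sub_mem_Sset_of_pow_ne_zero (right_ne_zero_of_mul hne)
    · rw [Matrix.submatrix_apply]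
      by_cases hA : A (e a) (e c) = 0
      · simp [hA]
      · rw [ih (l + 1) (by omega) c (sub_mem_Sset_succ ha hA)]

/-- Enlargement of the index set: if `i, j ∈ Δ_{ij}^{(k)}` and `M ⊇ Δ_{ij}^{(k)}` is any
subset of `{1,…,n}`, then `[p(A)]_{ij} = [p(C)]_{𝕆(i),𝕆(j)}` for every polynomial `p` of
degree at most `k`, where `C = A[M,M]` and `𝕆` is the order bijection on `M`. -/
theorem poly_entry_eq_enlarged_submatrix_poly_entry (n k : ℕ)
    (A : Matrix (Fin n) (Fin n) ℂ) (i j : Fin n) (Δ M : Finset (Fin n))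
    (hΔ : ∀ t : Fin n, t ∈ Δ ↔ ∃ s ≤ k, ∃ l ≤ s,
      (t : ℤ) - (i : ℤ) ∈ Sset n A l ∧ (j : ℤ) - (t : ℤ) ∈ Sset n A (s - l))
    (hi : i ∈ Δ) (hj : j ∈ Δ) (hΔM : Δ ⊆ M)
    (p : Polynomial ℂ) (hp : p.natDegree ≤ k) :
    (Polynomial.aeval A) p i j =
      (Polynomial.aeval
          (A.submatrix (fun a : Fin M.card => ((M.orderIsoOfFin rfl) a : Fin n))
            (fun a : Fin M.card => ((M.orderIsoOfFin rfl) a : Fin n)))) p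
        ((M.orderIsoOfFin rfl).symm ⟨i, hΔM hi⟩)
        ((M.orderIsoOfFin rfl).symm ⟨j, hΔM hj⟩) := by
  set e : Fin M.card → Fin n := fun a => ((M.orderIsoOfFin rfl) a : Fin n)
  have he : Function.Injective e := fun a b hab =>
    (M.orderIsoOfFin rfl).injective (Subtype.ext hab)
  set a := (M.orderIsoOfFin rfl).symm ⟨i, hΔM hi⟩
  set b := (M.orderIsoOfFin rfl).symm ⟨j, hΔM hj⟩
  have ha : e a = i := congrArg Subtype.val ((M.orderIsoOfFin rfl).apply_symm_apply _)
  have hb : e b = j := congrArg Subtype.val ((M.orderIsoOfFin rfl).apply_symm_apply _)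
  rw [Polynomial.aeval_eq_sum_range, Polynomial.aeval_eq_sum_range, Matrix.sum_apply,
    Matrix.sum_apply]
  refine Finset.sum_congr rfl fun s hs => ?_
  have hsk : s ≤ k := by
    have := Finset.mem_range.mp hs
    omega
  rw [Matrix.smul_apply, Matrix.smul_apply]
  congr 1
  have key := pow_apply_eq_submatrix_pow_apply_s5 A he i b s (fun u l hl h₁ h₂ => by
    rw [hb] at h₂
    have hu : u ∈ M := hΔM ((hΔ u).2 ⟨s, hsk, l, hl, h₁, h₂⟩)
    exact ⟨(M.orderIsoOfFin rfl).symm ⟨u, hu⟩,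
      congrArg Subtype.val ((M.orderIsoOfFin rfl).apply_symm_apply _)⟩) s 0 (zero_add s) a
    (by simp [ha, Sset])
  rwa [ha, hb] at key
end

section
/- (Limit of entries of functions of symmetric tridiagonal Toeplitz matrices.) Let b, c ∈ ℝ and, for each n ≥ 1, let T_n be the n×n real symmetric tridiagonal Toeplitz matrix with (T_n)_{ii} = c, (T_n)_{i,i+1} = (T_n)_{i+1,i} = b, and all other entries zero. Fix positive integers p and l, and let f : ℝ → ℝ be continuous. Then the sequence of entries [f(T_n)]_{pl} (defined for all n ≥ max(p,l)) converges as n → ∞, and lim_{n→∞} [f(T_n)]_{pl} = (1/π) ∫_0^π f(c + 2b·cos x) cos((p−l)x) dx − (1/π) ∫_0^π f(c + 2b·cos x) cos((p+l)x) dx. -/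
/-- For a real symmetric matrix `A = U diag(λ₁,…,λₙ) Uᵀ` and `f : ℝ → ℝ`, the matrix
function `f(A) := U diag(f(λ₁),…,f(λₙ)) Uᵀ` (via Mathlib's spectral decomposition). -/
noncomputable def hermApply {n : ℕ} (A : Matrix (Fin n) (Fin n) ℝ) (hA : A.IsHermitian)
    (f : ℝ → ℝ) : Matrix (Fin n) (Fin n) ℝ :=
  (hA.eigenvectorUnitary : Matrix (Fin n) (Fin n) ℝ) *
    Matrix.diagonal (fun t => f (hA.eigenvalues t)) *
    star (hA.eigenvectorUnitary : Matrix (Fin n) (Fin n) ℝ)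

theorem hermApply_apply {n : ℕ} (A : Matrix (Fin n) (Fin n) ℝ) (hA : A.IsHermitian)
    (f : ℝ → ℝ) (i j : Fin n) :
    hermApply A hA f i j =
      ∑ k, f (hA.eigenvalues k) *
        ((hA.eigenvectorUnitary : Matrix (Fin n) (Fin n) ℝ) i k *
          (hA.eigenvectorUnitary : Matrix (Fin n) (Fin n) ℝ) j k) := by
  rw [hermApply, Matrix.mul_apply]
  refine Finset.sum_congr rfl fun k _ => ?_
  rw [Matrix.mul_diagonal, Matrix.star_apply, star_trivial]
  ring

theorem hermApply_one {n : ℕ} (A : Matrix (Fin n) (Fin n) ℝ) (hA : A.IsHermitian) :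
    hermApply A hA (fun _ => 1) = 1 := by
  simp [hermApply]

theorem mul_hermApply {n : ℕ} (A : Matrix (Fin n) (Fin n) ℝ) (hA : A.IsHermitian)
    (f : ℝ → ℝ) : A * hermApply A hA f = hermApply A hA (fun x => x * f x) := by
  have hs : A * (hA.eigenvectorUnitary : Matrix (Fin n) (Fin n) ℝ) =
      (hA.eigenvectorUnitary : Matrix (Fin n) (Fin n) ℝ) *
        Matrix.diagonal (fun t => hA.eigenvalues t) := by
    ext i j
    rw [Matrix.mul_diagonal, Matrix.mul_apply]
    have h := congrFun (hA.mulVec_eigenvectorBasis j) i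
    simp only [Matrix.mulVec, dotProduct, Pi.smul_apply, smul_eq_mul] at h
    simpa [Matrix.IsHermitian.eigenvectorUnitary_apply, mul_comm] using h
  rw [hermApply, ← mul_assoc, ← mul_assoc, hs, mul_assoc _ (Matrix.diagonal _) (Matrix.diagonal _),
    Matrix.diagonal_mul_diagonal]
  rfl

theorem sum_sq_row_eigenvectorUnitary {n : ℕ} (A : Matrix (Fin n) (Fin n) ℝ)
    (hA : A.IsHermitian) (i : Fin n) :
    ∑ k, (hA.eigenvectorUnitary : Matrix (Fin n) (Fin n) ℝ) i k ^ 2 = 1 := by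
  have h := hermApply_apply A hA (fun _ => 1) i i
  rw [hermApply_one] at h
  simpa [sq] using h.symm

/-- Entries of `f(A)` and `g(A)` differ by at most the distance of `f` and `g` on a set containing
the spectrum. -/
theorem abs_hermApply_sub_le {n : ℕ} (A : Matrix (Fin n) (Fin n) ℝ) (hA : A.IsHermitian)
    (f g : ℝ → ℝ) (ε : ℝ) (h : ∀ k, |f (hA.eigenvalues k) - g (hA.eigenvalues k)| ≤ ε)
    (i j : Fin n) : |hermApply A hA f i j - hermApply A hA g i j| ≤ ε := by
  rw [hermApply_apply, hermApply_apply, ← Finset.sum_sub_distrib]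
  set U := (hA.eigenvectorUnitary : Matrix (Fin n) (Fin n) ℝ) with hU
  calc |∑ k, (f (hA.eigenvalues k) * (U i k * U j k) - g (hA.eigenvalues k) * (U i k * U j k))|
      ≤ ∑ k, |f (hA.eigenvalues k) * (U i k * U j k) - g (hA.eigenvalues k) * (U i k * U j k)| :=
        Finset.abs_sum_le_sum_abs _ _
    _ ≤ ∑ k, ε * ((U i k ^ 2 + U j k ^ 2) / 2) := by
        refine Finset.sum_le_sum fun k _ => ?_
        rw [← sub_mul, abs_mul]
        refine mul_le_mul (h k) ?_ (abs_nonneg _) ((abs_nonneg _).trans (h k))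
        rw [abs_le]
        constructor <;> nlinarith [sq_nonneg (U i k - U j k), sq_nonneg (U i k + U j k)]
    _ = ε := by
        rw [← Finset.mul_sum, ← Finset.sum_div, Finset.sum_add_distrib,
          sum_sq_row_eigenvectorUnitary, sum_sq_row_eigenvectorUnitary]
        ring

theorem sum_tridiag_mul (b c : ℝ) (n i : ℕ) (hi : i < n) (F : ℕ → ℝ) :
    ∑ j : Fin n, (if (i : ℤ) = (j : ℤ) then c else if |(i : ℤ) - (j : ℤ)| = 1 then b else 0) * F j =
      c * F i + (if i + 1 < n then b * F (i + 1) else 0) +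
        (if 0 < i then b * F (i - 1) else 0) := by
  rw [Fin.sum_univ_eq_sum_range (fun j : ℕ =>
    (if (i : ℤ) = (j : ℤ) then c else if |(i : ℤ) - (j : ℤ)| = 1 then b else 0) * F j) n]
  have key : ∀ j ∈ Finset.range n,
      (if (i : ℤ) = (j : ℤ) then c else if |(i : ℤ) - (j : ℤ)| = 1 then b else 0) * F j =
        (if j = i then c * F j else 0) + (if j = i + 1 then b * F j else 0) +
          (if j = i - 1 then (if 0 < i then b * F j else 0) else 0) := by
    intro j _
    have h1 : |(i : ℤ) - (j : ℤ)| = 1 ↔ j = i + 1 ∨ (j = i - 1 ∧ 0 < i) := by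
      rw [abs_eq (by norm_num)]
      omega
    simp only [h1]
    split_ifs <;> first | omega | simp
  rw [Finset.sum_congr rfl key, Finset.sum_add_distrib, Finset.sum_add_distrib,
    Finset.sum_ite_eq', Finset.sum_ite_eq', Finset.sum_ite_eq']
  have : i - 1 < n := by omega
  simp [hi, this]

theorem abs_eigenvalues_tridiag_le (b c : ℝ) {n : ℕ} (A : Matrix (Fin n) (Fin n) ℝ)
    (hA : A.IsHermitian)
    (hT : ∀ i j : Fin n, A i j =
      if (i : ℤ) = (j : ℤ) then c else if |(i : ℤ) - (j : ℤ)| = 1 then b else 0)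
    (k : Fin n) : |hA.eigenvalues k| ≤ 2 * |c| + 2 * |b| := by
  have hev : Module.End.HasEigenvalue (Matrix.toLin' A) (hA.eigenvalues k) := by
    refine Module.End.hasEigenvalue_of_hasEigenvector (x := ⇑(hA.eigenvectorBasis k)) ⟨?_, ?_⟩
    · rw [Module.End.mem_eigenspace_iff, Matrix.toLin'_apply]
      exact hA.mulVec_eigenvectorBasis k
    · intro h0
      apply hA.eigenvectorBasis.toBasis.ne_zero k
      ext i
      simpa using congrFun h0 i
  obtain ⟨i, hi⟩ := eigenvalue_mem_ball hev
  rw [Metric.mem_closedBall, Real.dist_eq] at hi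
  have hsum : ∑ j ∈ Finset.univ.erase i, ‖A i j‖ ≤ |c| + 2 * |b| := by
    calc ∑ j ∈ Finset.univ.erase i, ‖A i j‖ ≤ ∑ j, ‖A i j‖ :=
          Finset.sum_le_sum_of_subset_of_nonneg (Finset.erase_subset _ _)
            fun _ _ _ => norm_nonneg _
      _ = ∑ j : Fin n, (if ((i : ℕ) : ℤ) = (j : ℤ) then |c| else
            if |((i : ℕ) : ℤ) - (j : ℤ)| = 1 then |b| else 0) * (fun _ : ℕ => (1 : ℝ)) j := by
          refine Finset.sum_congr rfl fun j _ => ?_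
          rw [hT, Real.norm_eq_abs]
          split_ifs <;> simp
      _ ≤ |c| + 2 * |b| := by
          rw [sum_tridiag_mul |b| |c| n i i.2 (fun _ => 1)]
          have := abs_nonneg b
          split_ifs <;> linarith
  have hc : A i i = c := by simp [hT]
  rw [hc] at hi
  have h3 : |hA.eigenvalues k| ≤ |hA.eigenvalues k - c| + |c| := by
    simpa using abs_add_le (hA.eigenvalues k - c) c
  linarith

/-- The limit functional, written through the product formula for sines. -/
noncomputable def sineCoeff (b c : ℝ) (f : ℝ → ℝ) (p l : ℝ) : ℝ :=
  (2 / Real.pi) * ∫ x in (0 : ℝ)..Real.pi,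
    f (c + 2 * b * Real.cos x) * (Real.sin (p * x) * Real.sin (l * x))

theorem sineCoeff_eq (b c : ℝ) (f : ℝ → ℝ) (hf : Continuous f) (p l : ℝ) :
    sineCoeff b c f p l =
      (1 / Real.pi) * (∫ x in (0 : ℝ)..Real.pi,
        f (c + 2 * b * Real.cos x) * Real.cos ((p - l) * x)) -
      (1 / Real.pi) * (∫ x in (0 : ℝ)..Real.pi,
        f (c + 2 * b * Real.cos x) * Real.cos ((p + l) * x)) := by
  have h : (fun x => f (c + 2 * b * Real.cos x) * (Real.sin (p * x) * Real.sin (l * x))) =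
      fun x => (1 / 2) * (f (c + 2 * b * Real.cos x) * Real.cos ((p - l) * x) -
        f (c + 2 * b * Real.cos x) * Real.cos ((p + l) * x)) := by
    funext x
    rw [sub_mul, add_mul, Real.cos_sub, Real.cos_add]
    ring
  rw [sineCoeff, h, intervalIntegral.integral_const_mul, intervalIntegral.integral_sub]
  · ring
  all_goals exact Continuous.intervalIntegrable (by fun_prop) _ _

theorem sineCoeff_add (b c : ℝ) (f g : ℝ → ℝ) (hf : Continuous f) (hg : Continuous g)
    (p l : ℝ) :
    sineCoeff b c (fun x => f x + g x) p l = sineCoeff b c f p l + sineCoeff b c g p l := by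
  simp only [sineCoeff, add_mul]
  rw [intervalIntegral.integral_add, mul_add]
  all_goals exact Continuous.intervalIntegrable (by fun_prop) _ _

theorem sineCoeff_const_mul (b c a : ℝ) (f : ℝ → ℝ) (p l : ℝ) :
    sineCoeff b c (fun x => a * f x) p l = a * sineCoeff b c f p l := by
  simp only [sineCoeff, mul_assoc]
  rw [intervalIntegral.integral_const_mul]
  ring

theorem sineCoeff_zero_left (b c : ℝ) (f : ℝ → ℝ) (l : ℝ) : sineCoeff b c f 0 l = 0 := by
  simp [sineCoeff]

theorem sineCoeff_id_mul (b c : ℝ) (f : ℝ → ℝ) (hf : Continuous f) (p l : ℝ) :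
    sineCoeff b c (fun x => x * f x) p l =
      c * sineCoeff b c f p l + b * sineCoeff b c f (p + 1) l + b * sineCoeff b c f (p - 1) l := by
  have h : (fun x => (c + 2 * b * Real.cos x) * f (c + 2 * b * Real.cos x) *
        (Real.sin (p * x) * Real.sin (l * x))) =
      fun x => (c * (f (c + 2 * b * Real.cos x) * (Real.sin (p * x) * Real.sin (l * x))) +
        b * (f (c + 2 * b * Real.cos x) * (Real.sin ((p + 1) * x) * Real.sin (l * x)))) +
        b * (f (c + 2 * b * Real.cos x) * (Real.sin ((p - 1) * x) * Real.sin (l * x))) := by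
    funext x
    rw [sub_mul, add_mul p, one_mul, Real.sin_sub, Real.sin_add]
    ring
  simp only [sineCoeff]
  rw [h, intervalIntegral.integral_add, intervalIntegral.integral_add,
    intervalIntegral.integral_const_mul, intervalIntegral.integral_const_mul,
    intervalIntegral.integral_const_mul]
  · ring
  all_goals exact Continuous.intervalIntegrable (by fun_prop) _ _

theorem integral_cos_int_mul (m : ℤ) :
    ∫ x in (0 : ℝ)..Real.pi, Real.cos (m * x) = if m = 0 then Real.pi else 0 := by
  split_ifs with h
  · simp [h]
  · rw [intervalIntegral.integral_comp_mul_left (fun x => Real.cos x) (by exact_mod_cast h)]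
    simp [Real.sin_int_mul_pi]

theorem sineCoeff_one (b c : ℝ) (i j : ℕ) :
    sineCoeff b c (fun _ => 1) (i + 1) (j + 1) = if i = j then 1 else 0 := by
  rw [sineCoeff_eq _ _ _ continuous_const]
  have h1 := integral_cos_int_mul ((i : ℤ) - j)
  have h2 := integral_cos_int_mul ((i : ℤ) + j + 2)
  rw [if_neg (by omega)] at h2
  push_cast at h1 h2
  have e1 : ((i : ℝ) + 1 - (j + 1)) = i - j := by ring
  have e2 : ((i : ℝ) + 1 + (j + 1)) = i + j + 2 := by ring
  simp only [one_mul, e1, e2, h1, h2, sub_eq_zero, Nat.cast_inj]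
  split_ifs <;> simp [Real.pi_ne_zero]

theorem abs_sineCoeff_sub_le (b c : ℝ) (f g : ℝ → ℝ) (hf : Continuous f) (hg : Continuous g)
    (p l ε : ℝ) (h : ∀ x, |x| ≤ 2 * |c| + 2 * |b| → |f x - g x| ≤ ε) :
    |sineCoeff b c f p l - sineCoeff b c g p l| ≤ 2 * ε := by
  have hsub : sineCoeff b c f p l - sineCoeff b c g p l =
      (2 / Real.pi) * ∫ x in (0 : ℝ)..Real.pi,
        (f (c + 2 * b * Real.cos x) - g (c + 2 * b * Real.cos x)) *
          (Real.sin (p * x) * Real.sin (l * x)) := by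
    simp only [sineCoeff, sub_mul]
    rw [intervalIntegral.integral_sub, mul_sub]
    all_goals exact Continuous.intervalIntegrable (by fun_prop) _ _
  have hb : ‖∫ x in (0 : ℝ)..Real.pi,
        (f (c + 2 * b * Real.cos x) - g (c + 2 * b * Real.cos x)) *
          (Real.sin (p * x) * Real.sin (l * x))‖ ≤ ε * |Real.pi - 0| := by
    refine intervalIntegral.norm_integral_le_of_norm_le_const fun x _ => ?_
    have hx : |c + 2 * b * Real.cos x| ≤ 2 * |c| + 2 * |b| := by
      have h1 := abs_add_le c (2 * b * Real.cos x)
      have h2 : |2 * b * Real.cos x| ≤ 2 * |b| := by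
        rw [abs_mul, abs_mul, abs_two]
        exact mul_le_of_le_one_right (by positivity) (Real.abs_cos_le_one x)
      linarith [abs_nonneg c]
    rw [Real.norm_eq_abs, abs_mul, abs_mul]
    have h3 : |Real.sin (p * x)| * |Real.sin (l * x)| ≤ 1 :=
      mul_le_one₀ (Real.abs_sin_le_one _) (abs_nonneg _) (Real.abs_sin_le_one _)
    exact (mul_le_of_le_one_right (abs_nonneg _) h3).trans (h _ hx)
  have hpi := Real.pi_pos
  rw [hsub, abs_mul, abs_of_pos (by positivity : 0 < 2 / Real.pi)]
  rw [Real.norm_eq_abs, sub_zero, abs_of_pos hpi] at hb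
  calc _ ≤ (2 / Real.pi) * (ε * Real.pi) := by gcongr
    _ = 2 * ε := by field_simp

theorem hermApply_pow_tridiag (b c : ℝ) {n : ℕ} (A : Matrix (Fin n) (Fin n) ℝ)
    (hA : A.IsHermitian)
    (hT : ∀ i j : Fin n, A i j =
      if (i : ℤ) = (j : ℤ) then c else if |(i : ℤ) - (j : ℤ)| = 1 then b else 0)
    (k : ℕ) (i j : Fin n) (hik : i + k < n) :
    hermApply A hA (fun x => x ^ k) i j = sineCoeff b c (fun x => x ^ k) (i + 1) (j + 1) := by
  induction k generalizing i with
  | zero =>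
    simp only [pow_zero]
    rw [hermApply_one, sineCoeff_one, Matrix.one_apply]
    simp only [Fin.ext_iff]
  | succ k ih =>
    simp only [pow_succ']
    rw [← mul_hermApply, sineCoeff_id_mul _ _ _ (by fun_prop), Matrix.mul_apply]
    let F : ℕ → ℝ := fun m => if h : m < n then hermApply A hA (fun x => x ^ k) ⟨m, h⟩ j else 0
    have hF : ∀ m, m + k < n → F m = sineCoeff b c (fun x => x ^ k) (m + 1) (j + 1) := by
      intro m hm
      have hmn : m < n := by omega
      simp only [F, hmn, dif_pos]
      exact ih ⟨m, hmn⟩ hm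
    have hs := sum_tridiag_mul b c n i i.2 F
    have hl : ∑ m, A i m * hermApply A hA (fun x => x ^ k) m j = ∑ m : Fin n,
        (if ((i : ℕ) : ℤ) = (m : ℤ) then c else if |((i : ℕ) : ℤ) - (m : ℤ)| = 1 then b else 0) *
          F m := by
      refine Finset.sum_congr rfl fun m _ => ?_
      simp [hT, F]
    rw [hl, hs, if_pos (by omega), hF _ (by omega), hF _ (by omega)]
    split_ifs with h0
    · rw [hF _ (by omega), Nat.cast_sub h0]
      push_cast
      ring_nf
    · have : (i : ℕ) = 0 := by omega
      simp [this, sineCoeff_zero_left]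

open Polynomial in
theorem hermApply_polynomial_tridiag (b c : ℝ) {n : ℕ} (A : Matrix (Fin n) (Fin n) ℝ)
    (hA : A.IsHermitian)
    (hT : ∀ i j : Fin n, A i j =
      if (i : ℤ) = (j : ℤ) then c else if |(i : ℤ) - (j : ℤ)| = 1 then b else 0)
    (q : ℝ[X]) (i j : Fin n) (hiq : i + q.natDegree < n) :
    hermApply A hA (fun x => q.eval x) i j =
      sineCoeff b c (fun x => q.eval x) (i + 1) (j + 1) := by
  have hsum : ∀ m : ℕ, m ≤ q.natDegree + 1 →
      hermApply A hA (fun x => ∑ k ∈ Finset.range m, q.coeff k * x ^ k) i j =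
      sineCoeff b c (fun x => ∑ k ∈ Finset.range m, q.coeff k * x ^ k) (i + 1) (j + 1) := by
    intro m hm
    induction m with
    | zero => simp [hermApply_apply, sineCoeff]
    | succ m ih =>
      simp only [Finset.sum_range_succ]
      rw [sineCoeff_add _ _ _ _ (by fun_prop) (by fun_prop), sineCoeff_const_mul,
        ← ih (by omega), ← hermApply_pow_tridiag b c A hA hT m i j (by omega)]
      simp only [hermApply_apply, add_mul, Finset.sum_add_distrib, Finset.mul_sum, mul_assoc]
  simp only [eval_eq_sum_range]
  exact hsum _ le_rfl

/-- Limit of entries of functions of symmetric tridiagonal Toeplitz matrices: for the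
family `T n` of `n × n` real symmetric tridiagonal Toeplitz matrices with diagonal `c`
and off-diagonal `b`, fixed one-based indices `p, l ≥ 1`, and continuous `f : ℝ → ℝ`,
the entries `[f(T n)]_{pl}` (defined for `n ≥ max p l`) converge as `n → ∞` to
`(1/π)∫₀^π f(c+2b cos x) cos((p−l)x) dx − (1/π)∫₀^π f(c+2b cos x) cos((p+l)x) dx`. -/
theorem tridiag_toeplitz_entry_limit (b c : ℝ)
    (T : ∀ n : ℕ, Matrix (Fin n) (Fin n) ℝ)
    (hT : ∀ (n : ℕ) (i j : Fin n), T n i j =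
      if (i : ℤ) = (j : ℤ) then c else if |(i : ℤ) - (j : ℤ)| = 1 then b else 0)
    (hherm : ∀ n : ℕ, (T n).IsHermitian)
    (p l : ℕ) (hp : 1 ≤ p) (hl : 1 ≤ l)
    (f : ℝ → ℝ) (hf : Continuous f) :
    Filter.Tendsto
      (fun n : ℕ =>
        if h : p ≤ n ∧ l ≤ n then
          hermApply (T n) (hherm n) f ⟨p - 1, by omega⟩ ⟨l - 1, by omega⟩
        else 0)
      Filter.atTop
      (nhds
        ((1 / Real.pi) *
            (∫ x in (0 : ℝ)..Real.pi,
              f (c + 2 * b * Real.cos x) * Real.cos (((p : ℝ) - (l : ℝ)) * x)) -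
          (1 / Real.pi) *
            (∫ x in (0 : ℝ)..Real.pi,
              f (c + 2 * b * Real.cos x) * Real.cos (((p : ℝ) + (l : ℝ)) * x)))) := by
  rw [← sineCoeff_eq b c f hf, Metric.tendsto_atTop]
  intro ε hε
  set R := 2 * |c| + 2 * |b| with hR
  obtain ⟨q, hq⟩ := exists_polynomial_near_of_continuousOn (-R) R f hf.continuousOn (ε / 4)
    (by positivity)
  have hq' : ∀ x, |x| ≤ R → |f x - q.eval x| ≤ ε / 4 := fun x hx => by
    rw [abs_sub_comm]
    exact (hq x (abs_le.mp hx)).le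
  refine ⟨p + l + q.natDegree, fun n hn => ?_⟩
  have hpl : p ≤ n ∧ l ≤ n := by omega
  rw [dif_pos hpl, Real.dist_eq]
  have h1 := abs_hermApply_sub_le (T n) (hherm n) f (fun x => q.eval x) (ε / 4)
    (fun k => hq' _ (abs_eigenvalues_tridiag_le b c (T n) (hherm n) (hT n) k))
    ⟨p - 1, by omega⟩ ⟨l - 1, by omega⟩
  have h2 := abs_sineCoeff_sub_le b c f (fun x => q.eval x) hf q.continuous p l (ε / 4) hq'
  have h3 := hermApply_polynomial_tridiag b c (T n) (hherm n) (hT n) q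
    ⟨p - 1, by omega⟩ ⟨l - 1, by omega⟩ (by simp only; omega)
  simp only [Nat.cast_sub hp, Nat.cast_sub hl, Nat.cast_one, sub_add_cancel] at h3
  rw [h3] at h1
  rw [abs_le] at h1 h2
  rw [abs_lt]
  constructor <;> linarith
end
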